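/- Let V = ℂⁿ, and suppose the algebra (V, λ) lies in the closure of the GL(V)-orbit of (V, μ) under the change-of-basis action on bilinear maps (i.e. μ degenerates to λ). Then for any fixed Ω ∈ M(2×3, ℂ), dim Der_Ω(V,μ) ≤ dim Der_Ω(V,λ). -/

import Mathlib

noncomputable def bilinTop (n : ℕ) :
    TopologicalSpace ((Fin n → ℂ) →ₗ[ℂ] (Fin n → ℂ) →ₗ[ℂ] (Fin n → ℂ)) :=
  TopologicalSpace.induced
    (fun m => fun X Y : Fin n → ℂ => m X Y) inferInstance

noncomputable def DerOmega (n : ℕ) (a₁ a₂ a₃ a₄ a₅ a₆ : ℂ)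
    (μ : (Fin n → ℂ) →ₗ[ℂ] (Fin n → ℂ) →ₗ[ℂ] (Fin n → ℂ)) :
    Set (Module.End ℂ (Fin n → ℂ) × Module.End ℂ (Fin n → ℂ) × Module.End ℂ (Fin n → ℂ)) :=
  {t | a₁ • t.1 + a₂ • t.2.1 + a₃ • t.2.2 = 0 ∧
       a₄ • t.1 + a₅ • t.2.1 + a₆ • t.2.2 = 0 ∧
       ∀ X Y, t.1 (μ X Y) = μ (t.2.1 X) Y + μ X (t.2.2 Y)}


abbrev BilV (n : ℕ) := (Fin n → ℂ) →ₗ[ℂ] (Fin n → ℂ) →ₗ[ℂ] (Fin n → ℂ)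
abbrev EndV (n : ℕ) := Module.End ℂ (Fin n → ℂ)

/-- triples satisfying the two linear relations -/
def relSub (n : ℕ) (a₁ a₂ a₃ a₄ a₅ a₆ : ℂ) : Submodule ℂ (EndV n × EndV n × EndV n) :=
  LinearMap.ker
    ((a₁ • LinearMap.fst ℂ (EndV n) (EndV n × EndV n)
      + a₂ • (LinearMap.fst ℂ (EndV n) (EndV n) ∘ₗ LinearMap.snd ℂ (EndV n) (EndV n × EndV n))
      + a₃ • (LinearMap.snd ℂ (EndV n) (EndV n) ∘ₗ LinearMap.snd ℂ (EndV n) (EndV n × EndV n))).prod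
    (a₄ • LinearMap.fst ℂ (EndV n) (EndV n × EndV n)
      + a₅ • (LinearMap.fst ℂ (EndV n) (EndV n) ∘ₗ LinearMap.snd ℂ (EndV n) (EndV n × EndV n))
      + a₆ • (LinearMap.snd ℂ (EndV n) (EndV n) ∘ₗ LinearMap.snd ℂ (EndV n) (EndV n × EndV n))))

lemma mem_relSub (n : ℕ) (a₁ a₂ a₃ a₄ a₅ a₆ : ℂ) (t : EndV n × EndV n × EndV n) :
    t ∈ relSub n a₁ a₂ a₃ a₄ a₅ a₆ ↔ a₁ • t.1 + a₂ • t.2.1 + a₃ • t.2.2 = 0 ∧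
       a₄ • t.1 + a₅ • t.2.1 + a₆ • t.2.2 = 0 := by
  simp [relSub, LinearMap.mem_ker]

/-- the defect of the derivation identity on basis vectors -/
def defect (n : ℕ) (ν : BilV n) :
    (EndV n × EndV n × EndV n) →ₗ[ℂ] (Fin n → Fin n → Fin n → ℂ) where
  toFun t i j := t.1 (ν (Pi.single i 1) (Pi.single j 1))
    - ν (t.2.1 (Pi.single i 1)) (Pi.single j 1) - ν (Pi.single i 1) (t.2.2 (Pi.single j 1))
  map_add' s t := by
    funext i j
    simp only [Prod.fst_add, Prod.snd_add, LinearMap.add_apply, map_add, Pi.add_apply]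
    abel
  map_smul' c t := by
    funext i j
    simp only [Prod.smul_fst, Prod.smul_snd, LinearMap.smul_apply, map_smul, Pi.smul_apply,
      RingHom.id_apply, smul_sub]

lemma defect_eq_zero (n : ℕ) (ν : BilV n) (t : EndV n × EndV n × EndV n) :
    defect n ν t = 0 ↔ ∀ X Y, t.1 (ν X Y) = ν (t.2.1 X) Y + ν X (t.2.2 Y) := by
  constructor
  · intro h
    have key : ν.compr₂ t.1 = ν.comp t.2.1 + ν.compl₂ t.2.2 := by
      refine (Pi.basisFun ℂ (Fin n)).ext fun i => (Pi.basisFun ℂ (Fin n)).ext fun j => ?_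
      have := congrFun (congrFun h i) j
      change t.1 (ν (Pi.single i 1) (Pi.single j 1))
        - ν (t.2.1 (Pi.single i 1)) (Pi.single j 1)
        - ν (Pi.single i 1) (t.2.2 (Pi.single j 1)) = 0 at this
      rw [sub_sub, sub_eq_zero] at this
      simpa using this
    intro X Y
    have := LinearMap.congr_fun (LinearMap.congr_fun key X) Y
    simpa using this
  · intro h
    funext i j
    change t.1 (ν (Pi.single i 1) (Pi.single j 1))
        - ν (t.2.1 (Pi.single i 1)) (Pi.single j 1)
        - ν (Pi.single i 1) (t.2.2 (Pi.single j 1)) = 0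
    rw [sub_sub, sub_eq_zero, h]

def defectR (n : ℕ) (a₁ a₂ a₃ a₄ a₅ a₆ : ℂ) (ν : BilV n) :
    relSub n a₁ a₂ a₃ a₄ a₅ a₆ →ₗ[ℂ] (Fin n → Fin n → Fin n → ℂ) :=
  (defect n ν).comp (relSub n a₁ a₂ a₃ a₄ a₅ a₆).subtype

def derSub (n : ℕ) (a₁ a₂ a₃ a₄ a₅ a₆ : ℂ) (ν : BilV n) :
    Submodule ℂ (EndV n × EndV n × EndV n) :=
  (LinearMap.ker (defectR n a₁ a₂ a₃ a₄ a₅ a₆ ν)).map (relSub n a₁ a₂ a₃ a₄ a₅ a₆).subtype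

lemma coe_derSub (n : ℕ) (a₁ a₂ a₃ a₄ a₅ a₆ : ℂ) (ν : BilV n) :
    (derSub n a₁ a₂ a₃ a₄ a₅ a₆ ν : Set _) = DerOmega n a₁ a₂ a₃ a₄ a₅ a₆ ν := by
  ext t
  have e : t ∈ derSub n a₁ a₂ a₃ a₄ a₅ a₆ ν ↔
      t ∈ relSub n a₁ a₂ a₃ a₄ a₅ a₆ ∧ defect n ν t = 0 := by
    constructor
    · rintro ⟨s, hs, rfl⟩
      exact ⟨s.2, hs⟩
    · rintro ⟨h1, h2⟩
      exact ⟨⟨t, h1⟩, h2, rfl⟩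
  rw [SetLike.mem_coe, e, mem_relSub, defect_eq_zero, and_assoc]
  rfl

lemma finrank_DerOmega (n : ℕ) (a₁ a₂ a₃ a₄ a₅ a₆ : ℂ) (ν : BilV n) :
    Set.finrank ℂ (DerOmega n a₁ a₂ a₃ a₄ a₅ a₆ ν) =
      Module.finrank ℂ (derSub n a₁ a₂ a₃ a₄ a₅ a₆ ν) := by
  rw [Set.finrank, ← coe_derSub, Submodule.span_eq]

lemma rank_nullity (n : ℕ) (a₁ a₂ a₃ a₄ a₅ a₆ : ℂ) (ν : BilV n) :
    Module.finrank ℂ (LinearMap.range (defectR n a₁ a₂ a₃ a₄ a₅ a₆ ν)) +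
      Module.finrank ℂ (derSub n a₁ a₂ a₃ a₄ a₅ a₆ ν) =
      Module.finrank ℂ (relSub n a₁ a₂ a₃ a₄ a₅ a₆) := by
  have h := LinearMap.finrank_range_add_finrank_ker (K := ℂ)
    (V := relSub n a₁ a₂ a₃ a₄ a₅ a₆) (V₂ := Fin n → Fin n → Fin n → ℂ) (defectR n a₁ a₂ a₃ a₄ a₅ a₆ ν)
  have e := Submodule.finrank_map_subtype_eq (relSub n a₁ a₂ a₃ a₄ a₅ a₆)
    (LinearMap.ker (defectR n a₁ a₂ a₃ a₄ a₅ a₆ ν))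
  unfold derSub
  exact (congrArg (_ + ·) e).trans h

lemma orbit_le (n : ℕ) (a₁ a₂ a₃ a₄ a₅ a₆ : ℂ) (μ ν : BilV n)
    (g : (Fin n → ℂ) ≃ₗ[ℂ] (Fin n → ℂ))
    (hg : ∀ X Y, ν X Y = g (μ (g.symm X) (g.symm Y))) :
    Module.finrank ℂ (derSub n a₁ a₂ a₃ a₄ a₅ a₆ μ) ≤
      Module.finrank ℂ (derSub n a₁ a₂ a₃ a₄ a₅ a₆ ν) := by
  let c := g.conj
  let C := c.prodCongr (c.prodCongr c)
  rw [← LinearEquiv.finrank_map_eq C]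
  apply Submodule.finrank_mono
  rintro _ ⟨t, ht, rfl⟩
  rw [coe_derSub] at ht
  rw [← SetLike.mem_coe, coe_derSub]
  obtain ⟨h1, h2, h3⟩ := ht
  refine ⟨?_, ?_, ?_⟩
  · change a₁ • c t.1 + a₂ • c t.2.1 + a₃ • c t.2.2 = 0
    rw [← map_smul, ← map_smul, ← map_smul, ← map_add, ← map_add, h1, map_zero]
  · change a₄ • c t.1 + a₅ • c t.2.1 + a₆ • c t.2.2 = 0
    rw [← map_smul, ← map_smul, ← map_smul, ← map_add, ← map_add, h2, map_zero]
  · intro X Y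
    change g (t.1 (g.symm (ν X Y))) = ν (g (t.2.1 (g.symm X))) Y + ν X (g (t.2.2 (g.symm Y)))
    simp [hg, h3]

lemma continuous_eval (n : ℕ) (X Y : Fin n → ℂ) :
    @Continuous _ _ (bilinTop n) _ (fun ν : BilV n => ν X Y) := by
  let _ := bilinTop n
  have h : Continuous (fun m : BilV n => fun X Y : Fin n → ℂ => m X Y) := continuous_induced_dom
  exact (continuous_apply Y).comp ((continuous_apply X).comp h)

lemma continuous_defect (n : ℕ) (t : EndV n × EndV n × EndV n) :
    @Continuous _ _ (bilinTop n) _ (fun ν : BilV n => defect n ν t) := by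
  let _ := bilinTop n
  refine continuous_pi fun i => continuous_pi fun j => ?_
  exact (((LinearMap.continuous_of_finiteDimensional t.1).comp (continuous_eval n _ _)).sub
    (continuous_eval n _ _)).sub (continuous_eval n _ _)

theorem stmt18 (n : ℕ) (a₁ a₂ a₃ a₄ a₅ a₆ : ℂ)
    (μ lam : (Fin n → ℂ) →ₗ[ℂ] (Fin n → ℂ) →ₗ[ℂ] (Fin n → ℂ))
    (hdeg : lam ∈ @closure _ (bilinTop n)
      {ν | ∃ g : (Fin n → ℂ) ≃ₗ[ℂ] (Fin n → ℂ),
        ∀ X Y, ν X Y = g (μ (g.symm X) (g.symm Y))}) :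
    Set.finrank ℂ (DerOmega n a₁ a₂ a₃ a₄ a₅ a₆ μ) ≤
      Set.finrank ℂ (DerOmega n a₁ a₂ a₃ a₄ a₅ a₆ lam) := by
  rw [finrank_DerOmega, finrank_DerOmega]
  let R := LinearMap.range (defectR n a₁ a₂ a₃ a₄ a₅ a₆ lam)
  let b := Module.finBasis ℂ R
  choose w hw using fun i => (b i).2
  have hli : LinearIndependent ℂ (fun i => defectR n a₁ a₂ a₃ a₄ a₅ a₆ lam (w i)) := by
    have h := b.linearIndependent.map' R.subtype R.ker_subtype
    have e : (fun i => defectR n a₁ a₂ a₃ a₄ a₅ a₆ lam (w i)) = R.subtype ∘ b := funext hw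
    rw [e]
    exact h
  let _ := bilinTop n
  have hc : Continuous (fun ν : BilV n => fun i => defectR n a₁ a₂ a₃ a₄ a₅ a₆ ν (w i)) :=
    continuous_pi fun i => continuous_defect n (w i)
  have hopen := (isOpen_setOfPred_linearIndependent (𝕜 := ℂ)
    (E := Fin n → Fin n → Fin n → ℂ) (ι := Fin (Module.finrank ℂ R))).preimage hc
  obtain ⟨ν, hν, g, hg⟩ := mem_closure_iff.1 hdeg _ hopen hli
  have h1 := orbit_le n a₁ a₂ a₃ a₄ a₅ a₆ μ ν g hg
  have h2 := rank_nullity n a₁ a₂ a₃ a₄ a₅ a₆ ν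
  have h3 := rank_nullity n a₁ a₂ a₃ a₄ a₅ a₆ lam
  have h4 : Module.finrank ℂ R ≤
      Module.finrank ℂ (LinearMap.range (defectR n a₁ a₂ a₃ a₄ a₅ a₆ ν)) := by
    have hν' : LinearIndependent ℂ (fun i => (defectR n a₁ a₂ a₃ a₄ a₅ a₆ ν).rangeRestrict (w i)) :=
      LinearIndependent.of_comp (LinearMap.range (defectR n a₁ a₂ a₃ a₄ a₅ a₆ ν)).subtype hν
    simpa using hν'.fintype_card_le_finrank
  change Module.finrank ℂ R + _ = _ at h3
  omega
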